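/- Let f : ℝ^d → ℝ be a continuous bounded 1-periodic function. Then f belongs to B^1_{∞,∞} in the approximation sense (with N = 2) if and only if sup_{x ∈ ℝ^d, y ≠ 0} |f(x+y) + f(x-y) - 2f(x)| / ‖y‖ < ∞. -/

import Mathlib

open MeasureTheory Real ENNReal

noncomputable section

/-- The rescaled kernel `K_h(t) = h^{-d} K(t/h)`. -/
def resKer (d : ℕ) (K : EuclideanSpace ℝ (Fin d) → ℝ) (h : ℝ) :
    EuclideanSpace ℝ (Fin d) → ℝ :=
  fun t => (h ^ d)⁻¹ * K (h⁻¹ • t)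

/-- Convolution `(g * f)(t) = ∫ g(t-u) f(u) du` on `ℝ^d`. -/
def convol (d : ℕ) (g f : EuclideanSpace ℝ (Fin d) → ℝ) :
    EuclideanSpace ℝ (Fin d) → ℝ :=
  fun t => ∫ u, g (t - u) * f u

/-- The sup-norm `‖f‖_∞` (essential supremum of `|f|` over `ℝ^d`), with values in `ℝ≥0∞`. -/
def supNorm (d : ℕ) (f : EuclideanSpace ℝ (Fin d) → ℝ) : ℝ≥0∞ :=
  eLpNorm f ⊤ volume

/-- `f` is 1-periodic: `f(x + e_i) = f(x)` for every standard basis vector `e_i`. -/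
def Per1 (d : ℕ) (f : EuclideanSpace ℝ (Fin d) → ℝ) : Prop :=
  ∀ x (i : Fin d), f (x + EuclideanSpace.single i 1) = f x

/-- `f` is bounded and measurable. -/
def BddMeas (d : ℕ) (f : EuclideanSpace ℝ (Fin d) → ℝ) : Prop :=
  Measurable f ∧ ∃ M, ∀ x, |f x| ≤ M

/-- The partial derivative `∂f/∂t_i`. -/
def pderiv1 (d : ℕ) (i : Fin d) (f : EuclideanSpace ℝ (Fin d) → ℝ) :
    EuclideanSpace ℝ (Fin d) → ℝ :=
  fun x => fderiv ℝ f x (EuclideanSpace.single i 1)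

/-- The partial derivative `∂^α f = ∂^{α_1}_{t_1} ⋯ ∂^{α_d}_{t_d} f` for a multi-index `α`. -/
def pderivM (d : ℕ) (α : Fin d → ℕ) (f : EuclideanSpace ℝ (Fin d) → ℝ) :
    EuclideanSpace ℝ (Fin d) → ℝ :=
  (List.finRange d).foldr (fun i g => (pderiv1 d i)^[α i] g) f

/-- The kernel class `K(N)`: conditions (A1)–(A6) of the paper. -/
def KernelClass (d N : ℕ) (K : EuclideanSpace ℝ (Fin d) → ℝ) : Prop :=
  -- (A1) compact support
  HasCompactSupport K ∧
  -- (A2) square-integrable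
  Integrable (fun u => K u ^ 2) ∧
  -- (A3) L² increment bound
  (∃ C > 0, ∃ γ ∈ Set.Ioc (0 : ℝ) 1, ∀ t : EuclideanSpace ℝ (Fin d), ‖t‖ ≤ 1 →
    ∫ u, (K (t + u) - K u) ^ 2 ≤ C * ‖t‖ ^ (2 * γ)) ∧
  -- (A4) unit mass
  (∫ u, K u) = 1 ∧
  -- (A5) smoothness and integrable partial derivatives up to order N
  (ContDiff ℝ N K ∧ ∀ α : Fin d → ℕ, (∑ i, α i) ≤ N →
    Integrable (fun t => |pderivM d α K t|)) ∧
  -- (A6) vanishing moments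
  (∀ α : Fin d → ℕ, 1 ≤ (∑ i, α i) → (∑ i, α i) ≤ N →
    ∫ u, (∏ i, u i ^ α i) * K u = 0)

/-- The bandwidth class `H`: `h_n = 2^{-m_n}` with `(m_n)` nondecreasing positive integers
tending to `∞` and with bounded increments. -/
def BandClass (h : ℕ → ℝ) : Prop :=
  ∃ m : ℕ → ℕ, (∀ n, 0 < m n) ∧ Monotone m ∧
    Filter.Tendsto m Filter.atTop Filter.atTop ∧
    (∃ B : ℕ, ∀ n, m (n + 1) - m n ≤ B) ∧
    ∀ n, h n = (2 : ℝ) ^ (-(m n : ℝ))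

/-- `f` belongs to the Besov space `B^β_{∞,∞}` in the approximation sense: there are bounded
1-periodic `C^N` functions `f_j` with `sup_j 2^{jβ} ‖f - f_j‖_∞ < ∞` and
`sup_j 2^{-(N-β)j} ‖∂^α f_j‖_∞ < ∞` for every multi-index `α` with `|α| = N`. -/
def MemBesov (d : ℕ) (β : ℝ) (N : ℕ) (f : EuclideanSpace ℝ (Fin d) → ℝ) : Prop :=
  ∃ fs : ℕ → EuclideanSpace ℝ (Fin d) → ℝ,
    (∀ j, 1 ≤ j → (∃ M, ∀ x, |fs j x| ≤ M) ∧ Per1 d (fs j) ∧ ContDiff ℝ N (fs j)) ∧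
    (∃ C : ℝ, ∀ j : ℕ, 1 ≤ j →
      supNorm d (fun x => f x - fs j x) ≤ ENNReal.ofReal (C * 2 ^ (-(j : ℝ) * β))) ∧
    (∃ C : ℝ, ∀ α : Fin d → ℕ, (∑ i, α i) = N → ∀ j : ℕ, 1 ≤ j →
      supNorm d (pderivM d α (fs j)) ≤ ENNReal.ofReal (C * 2 ^ (((N : ℝ) - β) * j)))

/-- The Hölder class `Σ(β)`: `f` is a bounded 1-periodic function of class `C^m`
(`m` the largest integer strictly less than `β`) all of whose partial derivatives of order `m`
are `(β-m)`-Hölder. -/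
def HolderSigma (d : ℕ) (β : ℝ) (f : EuclideanSpace ℝ (Fin d) → ℝ) : Prop :=
  ∃ m : ℕ, (m : ℝ) < β ∧ β ≤ (m : ℝ) + 1 ∧
    ContDiff ℝ m f ∧ (∃ M, ∀ x, |f x| ≤ M) ∧ Per1 d f ∧
    ∀ σ : Fin d → ℕ, (∑ i, σ i) = m → ∃ C : ℝ, ∀ x y,
      |pderivM d σ f x - pderivM d σ f y| ≤ C * ‖x - y‖ ^ (β - (m : ℝ))

end

/-- A mixed partial derivative is an iterated partial derivative along the list of directions
that repeats the direction `i` exactly `α i` times. -/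
theorem pderivM_eq_foldr (d : ℕ) (α : Fin d → ℕ) (f : EuclideanSpace ℝ (Fin d) → ℝ) :
    pderivM d α f =
      ((List.finRange d).flatMap fun i => List.replicate (α i) i).foldr (pderiv1 d) f := by
  have hrep : ∀ (i : Fin d) (n : ℕ) (g : EuclideanSpace ℝ (Fin d) → ℝ),
      (List.replicate n i).foldr (pderiv1 d) g = (pderiv1 d i)^[n] g := by
    intro i n g
    induction n with
    | zero => rfl
    | succ n ih => rw [List.replicate_succ, List.foldr_cons, ih, Function.iterate_succ_apply']
  simp only [pderivM, List.foldr_flatMap, hrep]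

theorem exists_pderivM_eq_pderiv1_pderiv1 {d : ℕ} {α : Fin d → ℕ} (hα : ∑ i, α i = 2) :
    ∃ i k, ∀ f, pderivM d α f = pderiv1 d i (pderiv1 d k f) := by
  have hlen : ((List.finRange d).flatMap fun i => List.replicate (α i) i).length = 2 := by
    simp [List.length_flatMap, ← hα, Fin.sum_univ_def]
  obtain ⟨i, k, h⟩ := List.length_eq_two.mp hlen
  exact ⟨i, k, fun f => by rw [pderivM_eq_foldr, h]; rfl⟩

theorem contDiff_pderiv1 {d : ℕ} {f : EuclideanSpace ℝ (Fin d) → ℝ} {m n : WithTop ℕ∞}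
    (hf : ContDiff ℝ n f) (hmn : m + 1 ≤ n) (i : Fin d) : ContDiff ℝ m (pderiv1 d i f) :=
  (hf.fderiv_right hmn).clm_apply contDiff_const

theorem pderiv1_pderiv1_apply {d : ℕ} {f : EuclideanSpace ℝ (Fin d) → ℝ}
    (hf : ContDiff ℝ 2 f) (i k : Fin d) (x : EuclideanSpace ℝ (Fin d)) :
    pderiv1 d i (pderiv1 d k f) x =
      fderiv ℝ (fderiv ℝ f) x (EuclideanSpace.single i 1) (EuclideanSpace.single k 1) := by
  have hd : DifferentiableAt ℝ (fderiv ℝ f) x :=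
    ((hf.fderiv_right (m := 1) (by norm_num)).differentiable one_ne_zero) x
  unfold pderiv1
  rw [fderiv_clm_apply hd (differentiableAt_const _)]
  simp

theorem pderiv1_comm {d : ℕ} {f : EuclideanSpace ℝ (Fin d) → ℝ}
    (hf : ContDiff ℝ 2 f) (i k : Fin d) :
    pderiv1 d i (pderiv1 d k f) = pderiv1 d k (pderiv1 d i f) := by
  ext x
  rw [pderiv1_pderiv1_apply hf, pderiv1_pderiv1_apply hf]
  exact (hf.contDiffAt.isSymmSndFDerivAt (by simp)) _ _

theorem exists_pderiv1_pderiv1_eq_pderivM {d : ℕ} (i k : Fin d) :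
    ∃ α : Fin d → ℕ, ∑ l, α l = 2 ∧ ∀ f, ContDiff ℝ 2 f →
      pderiv1 d i (pderiv1 d k f) = pderivM d α f := by
  refine ⟨fun l => [i, k].count l, ?_, fun f hf => ?_⟩
  · simp [List.count_cons, Finset.sum_add_distrib]
  · have hperm : ((List.finRange d).flatMap fun l => List.replicate ([i, k].count l) l).Perm
        [i, k] := by
      rw [List.perm_iff_count]
      intro a
      rw [List.count_flatMap]
      simp only [Function.comp_def, List.count_replicate]
      rw [← Fin.sum_univ_def]
      simp
    rw [pderivM_eq_foldr]
    rcases List.perm_pair.mp hperm with h | h <;> rw [h]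
    · rfl
    · exact pderiv1_comm hf i k

theorem ContinuousLinearMap.opNorm_le_card_mul {d : ℕ} {F : Type*} [NormedAddCommGroup F]
    [NormedSpace ℝ F] (L : EuclideanSpace ℝ (Fin d) →L[ℝ] F) {B : ℝ} (hB : 0 ≤ B)
    (h : ∀ i, ‖L (EuclideanSpace.single i 1)‖ ≤ B) : ‖L‖ ≤ d * B := by
  refine L.opNorm_le_bound (by positivity) fun v => ?_
  have hv : v = ∑ i, v i • EuclideanSpace.single i (1 : ℝ) := by
    simpa using ((EuclideanSpace.basisFun (Fin d) ℝ).sum_repr v).symm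
  calc ‖L v‖ = ‖∑ i, v i • L (EuclideanSpace.single i 1)‖ := by
        conv_lhs => rw [hv]
        simp only [map_sum, map_smul]
    _ ≤ ∑ i, ‖v i • L (EuclideanSpace.single i 1)‖ := norm_sum_le _ _
    _ ≤ ∑ _i : Fin d, ‖v‖ * B := by
        refine Finset.sum_le_sum fun i _ => ?_
        rw [norm_smul]
        exact mul_le_mul (PiLp.norm_apply_le v i) (h i) (norm_nonneg _) (norm_nonneg _)
    _ = d * B * ‖v‖ := by simp; ring

theorem abs_second_difference_le {d : ℕ} {g : EuclideanSpace ℝ (Fin d) → ℝ}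
    (hg : ContDiff ℝ 2 g) {B : ℝ} (hB : 0 ≤ B)
    (h : ∀ i k x, |pderiv1 d i (pderiv1 d k g) x| ≤ B) (x y : EuclideanSpace ℝ (Fin d)) :
    |g (x + y) + g (x - y) - 2 * g x| ≤ 2 * (d * (d * B)) * ‖y‖ ^ 2 := by
  set L : ℝ := d * (d * B)
  have hL : 0 ≤ L := by positivity
  have hg1 : Differentiable ℝ g := hg.differentiable two_ne_zero
  have hg2 : Differentiable ℝ (fderiv ℝ g) :=
    (hg.fderiv_right (m := 1) (by norm_num)).differentiable one_ne_zero
  have hsnd : ∀ z, ‖fderiv ℝ (fderiv ℝ g) z‖ ≤ L := fun z =>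
    ContinuousLinearMap.opNorm_le_card_mul _ (by positivity) fun i =>
      ContinuousLinearMap.opNorm_le_card_mul _ hB fun k => by
        rw [← pderiv1_pderiv1_apply hg]; exact h i k z
  have hlip : ∀ a b, ‖fderiv ℝ g a - fderiv ℝ g b‖ ≤ L * ‖a - b‖ := fun a b =>
    convex_univ.norm_image_sub_le_of_norm_fderiv_le (fun z _ => hg2 z) (fun z _ => hsnd z)
      (Set.mem_univ b) (Set.mem_univ a)
  have hderiv : ∀ v, HasFDerivAt (fun v => g (x + v) + g (x - v))
      (fderiv ℝ g (x + v) - fderiv ℝ g (x - v)) v := by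
    intro v
    have h1 : HasFDerivAt (fun v => g (x + v)) (fderiv ℝ g (x + v)) v :=
      (hasFDerivAt_comp_add_left x).2 (hg1 _).hasFDerivAt
    have h2 : HasFDerivAt (fun v => g (x - v)) (-fderiv ℝ g (x - v)) v := by
      have := (hg1 (x - v)).hasFDerivAt.comp v ((hasFDerivAt_id v).const_sub x)
      simpa [Function.comp_def] using! this
    simpa [sub_eq_add_neg] using! h1.add h2
  have key := (convex_closedBall
    (0 : EuclideanSpace ℝ (Fin d)) ‖y‖).norm_image_sub_le_of_norm_hasFDerivWithin_le
    (C := L * (2 * ‖y‖)) (x := 0) (y := y)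
    (fun v _ => (hderiv v).hasFDerivWithinAt) (fun v hv => by
      refine (hlip _ _).trans (mul_le_mul_of_nonneg_left ?_ hL)
      have : x + v - (x - v) = (2 : ℝ) • v := by rw [two_smul]; abel
      rw [this, norm_smul]
      simpa using hv) (by simp) (by simp)
  simp only [add_zero, sub_zero, Real.norm_eq_abs] at key
  rw [show g (x + y) + g (x - y) - 2 * g x = g (x + y) + g (x - y) - (g x + g x) by ring]
  exact key.trans_eq (by ring)

theorem abs_le_of_supNorm_le {d : ℕ} {g : EuclideanSpace ℝ (Fin d) → ℝ} (hg : Continuous g)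
    {B : ℝ} (hB : 0 ≤ B) (h : supNorm d g ≤ ENNReal.ofReal B) (x : EuclideanSpace ℝ (Fin d)) :
    |g x| ≤ B := by
  rw [supNorm, eLpNorm_exponent_top] at h
  have hae : ∀ᵐ z ∂(volume : Measure (EuclideanSpace ℝ (Fin d))), |g z| ≤ B := by
    filter_upwards [ae_le_eLpNormEssSup (f := g)] with z hz
    have := hz.trans h
    rwa [← ofReal_norm, ENNReal.ofReal_le_ofReal_iff hB] at this
  have hclosed : IsClosed {z | |g z| ≤ B} := isClosed_le hg.abs continuous_const
  have := (Measure.dense_of_ae hae).closure_eq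
  rw [hclosed.closure_eq] at this
  exact this.ge (Set.mem_univ x)

theorem supNorm_le_ofReal {d : ℕ} {g : EuclideanSpace ℝ (Fin d) → ℝ} {B : ℝ}
    (h : ∀ x, |g x| ≤ B) : supNorm d g ≤ ENNReal.ofReal B := by
  rw [supNorm, eLpNorm_exponent_top]
  refine eLpNormEssSup_le_of_ae_enorm_bound (ae_of_all _ fun x => ?_)
  rw [← ofReal_norm]
  exact ENNReal.ofReal_le_ofReal (h x)

/-- A function approximated at each dyadic scale `2 ^ (-j)` by `C²` functions whose second
derivatives are `O(2 ^ j)` has second symmetric differences `O(‖y‖)`. -/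
theorem exists_abs_second_difference_le_of_memBesov {d : ℕ}
    {f : EuclideanSpace ℝ (Fin d) → ℝ} (hfc : Continuous f) (hfb : ∃ M, ∀ x, |f x| ≤ M)
    (hf : MemBesov d 1 2 f) :
    ∃ C : ℝ, ∀ x y : EuclideanSpace ℝ (Fin d), y ≠ 0 →
      |f (x + y) + f (x - y) - 2 * f x| ≤ C * ‖y‖ := by
  obtain ⟨M, hM⟩ := hfb
  obtain ⟨fs, hfs, ⟨C₁, hC₁⟩, ⟨C₂, hC₂⟩⟩ := hf
  have happ : ∀ j, 1 ≤ j → ∀ x, |f x - fs j x| ≤ |C₁| * (1 / 2) ^ j := by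
    intro j hj
    refine abs_le_of_supNorm_le (hfc.sub (hfs j hj).2.2.continuous) (by positivity) ?_
    refine (hC₁ j hj).trans (ENNReal.ofReal_le_ofReal ?_)
    rw [mul_one, Real.rpow_neg two_pos.le, Real.rpow_natCast, one_div, inv_pow]
    gcongr
    exact le_abs_self _
  have hder : ∀ j, 1 ≤ j → ∀ i k x, |pderiv1 d i (pderiv1 d k (fs j)) x| ≤ |C₂| * 2 ^ j := by
    intro j hj i k
    have hfj : ContDiff ℝ 2 (fs j) := (hfs j hj).2.2
    obtain ⟨α, hα, h⟩ := exists_pderiv1_pderiv1_eq_pderivM i k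
    refine abs_le_of_supNorm_le (contDiff_pderiv1 (m := 0) (n := 1)
      (contDiff_pderiv1 hfj (by norm_num) k) (by norm_num) i).continuous (by positivity) ?_
    rw [h _ hfj]
    refine (hC₂ α hα j hj).trans (ENNReal.ofReal_le_ofReal ?_)
    rw [show ((2 : ℕ) : ℝ) - 1 = 1 by norm_num, one_mul, Real.rpow_natCast]
    gcongr
    exact le_abs_self _
  have hM0 : 0 ≤ M := (abs_nonneg _).trans (hM 0)
  refine ⟨4 * M + 4 * |C₁| + 4 * (d * (d * |C₂|)), fun x y hy => ?_⟩
  have hy0 : 0 < ‖y‖ := norm_pos_iff.mpr hy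
  set D : ℝ := d * (d * |C₂|) with hD
  have hD0 : 0 ≤ D := by positivity
  rcases lt_or_ge 1 ‖y‖ with hy1 | hy1
  · have h1 := abs_le.mp (hM (x + y))
    have h2 := abs_le.mp (hM (x - y))
    have h3 := abs_le.mp (hM x)
    have h4 : |f (x + y) + f (x - y) - 2 * f x| ≤ 4 * M := by
      rw [abs_le]; constructor <;> linarith
    have h5 : 0 ≤ (4 * |C₁| + 4 * D) * ‖y‖ := by positivity
    nlinarith
  · obtain ⟨n, hn1, hn2⟩ := exists_nat_pow_near_of_lt_one hy0 hy1
      (show (0 : ℝ) < 1 / 2 by norm_num) (by norm_num)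
    have hj : 1 ≤ n + 1 := by omega
    have h1 := abs_le.mp (happ _ hj (x + y))
    have h2 := abs_le.mp (happ _ hj (x - y))
    have h3 := abs_le.mp (happ _ hj x)
    have h4 := abs_le.mp (abs_second_difference_le (hfs _ hj).2.2 (by positivity)
      (hder _ hj) x y)
    have h5 : 2 * (d * (d * (|C₂| * 2 ^ (n + 1)))) * ‖y‖ ^ 2 ≤ 4 * D * ‖y‖ := by
      have h6 : (2 : ℝ) ^ n * ‖y‖ ≤ 1 := by
        calc (2 : ℝ) ^ n * ‖y‖ ≤ 2 ^ n * (1 / 2) ^ n := by gcongr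
          _ = 1 := by rw [← mul_pow]; norm_num
      calc 2 * (d * (d * (|C₂| * 2 ^ (n + 1)))) * ‖y‖ ^ 2
          = 4 * D * ‖y‖ * (2 ^ n * ‖y‖) := by rw [hD]; ring
        _ ≤ 4 * D * ‖y‖ * 1 := by gcongr
        _ = 4 * D * ‖y‖ := mul_one _
    have h7 : |C₁| * (1 / 2) ^ (n + 1) ≤ |C₁| * ‖y‖ := by gcongr
    have h8 : 0 ≤ M * ‖y‖ := by positivity
    rw [abs_le]
    constructor <;> nlinarith

theorem pderiv1_comp_smul {d : ℕ} (i : Fin d) (c : ℝ) (G : EuclideanSpace ℝ (Fin d) → ℝ) :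
    pderiv1 d i (fun x => G (c • x)) = fun x => c * pderiv1 d i G (c • x) := by
  ext x
  simp [pderiv1, fderiv_comp_smul]

theorem pderiv1_const_mul {d : ℕ} (i : Fin d) (c : ℝ) (G : EuclideanSpace ℝ (Fin d) → ℝ) :
    pderiv1 d i (fun x => c * G x) = fun x => c * pderiv1 d i G x := by
  ext x
  change fderiv ℝ (c • G) x _ = _
  rw [fderiv_const_smul_field]
  rfl

theorem pderiv1_pderiv1_even {d : ℕ} (i k : Fin d) {K : EuclideanSpace ℝ (Fin d) → ℝ}
    (hK : ∀ t, K (-t) = K t) (t : EuclideanSpace ℝ (Fin d)) :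
    pderiv1 d i (pderiv1 d k K) (-t) = pderiv1 d i (pderiv1 d k K) t := by
  have h : (fun x => K ((-1 : ℝ) • x)) = K := by ext x; simp [hK]
  have h1 : pderiv1 d k K = fun x => -1 * pderiv1 d k K ((-1 : ℝ) • x) := by
    conv_lhs => rw [← h]
    exact pderiv1_comp_smul k (-1) K
  have h2 : pderiv1 d i (pderiv1 d k K) =
      fun x => -1 * (-1 * pderiv1 d i (pderiv1 d k K) ((-1 : ℝ) • x)) := by
    conv_lhs => rw [h1]
    rw [pderiv1_const_mul, pderiv1_comp_smul]
  conv_rhs => rw [h2]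
  simp

theorem hasCompactSupport_pderiv1 {d : ℕ} (i : Fin d) {K : EuclideanSpace ℝ (Fin d) → ℝ}
    (hK : HasCompactSupport K) : HasCompactSupport (pderiv1 d i K) :=
  hK.fderiv_apply ℝ _

theorem pderiv1_convolution {d : ℕ} (i : Fin d) {F K : EuclideanSpace ℝ (Fin d) → ℝ}
    (hF : Continuous F) (hK : HasCompactSupport K) (hK1 : ContDiff ℝ 1 K) :
    pderiv1 d i (convolution F K (ContinuousLinearMap.mul ℝ ℝ) volume) =
      convolution F (pderiv1 d i K) (ContinuousLinearMap.mul ℝ ℝ) volume := by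
  ext x
  rw [pderiv1, (hK.hasFDerivAt_convolution_right _ hF.locallyIntegrable hK1 x).fderiv,
    convolution_precompR_apply _ hF.locallyIntegrable (hK.fderiv ℝ)
      (hK1.continuous_fderiv one_ne_zero)]
  rfl

theorem integral_pderiv1_eq_zero {d : ℕ} (i : Fin d) {K : EuclideanSpace ℝ (Fin d) → ℝ}
    (hK : HasCompactSupport K) (hK1 : ContDiff ℝ 1 K) : ∫ t, pderiv1 d i K t = 0 := by
  have hconv : ∀ G : EuclideanSpace ℝ (Fin d) → ℝ,
      convolution (fun _ => 1) G (ContinuousLinearMap.mul ℝ ℝ) volume =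
        fun _ => ∫ t, G t := by
    intro G
    ext x
    rw [convolution_eq_swap]
    simp
  have h := pderiv1_convolution i (F := fun _ => 1) continuous_const hK hK1
  rw [hconv, hconv] at h
  have h0 := congrFun h 0
  simpa [pderiv1] using h0.symm

/-- Convolution with an even kernel, minus the kernel's mass times the identity, is an average
of second symmetric differences. -/
theorem abs_convolution_sub_le {d : ℕ} {F K : EuclideanSpace ℝ (Fin d) → ℝ} {A : ℝ}
    (hF : Continuous F) (hFA : ∀ x y, |F (x + y) + F (x - y) - 2 * F x| ≤ A * ‖y‖)
    (hK : HasCompactSupport K) (hKc : Continuous K) (heven : ∀ t, K (-t) = K t)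
    (x : EuclideanSpace ℝ (Fin d)) :
    |convolution F K (ContinuousLinearMap.mul ℝ ℝ) volume x - (∫ t, K t) * F x| ≤
      A * ∫ t, ‖t‖ * |K t| := by
  have hint : ∀ G : EuclideanSpace ℝ (Fin d) → ℝ, Continuous G →
      Integrable (fun t => G t * K t) := fun G hG =>
    (hG.mul hKc).integrable_of_hasCompactSupport hK.mul_left
  have h1 : convolution F K (ContinuousLinearMap.mul ℝ ℝ) volume x =
      ∫ t, F (x - t) * K t := by
    rw [convolution_eq_swap]; rfl
  have h2 : ∫ t, F (x - t) * K t = ∫ t, F (x + t) * K t := by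
    rw [← integral_neg_eq_self]
    simp [heven]
  have i1 := hint (fun t => F (x + t)) (by fun_prop)
  have i2 := hint (fun t => F (x - t)) (by fun_prop)
  have i3 := hint (fun _ => 2 * F x) (by fun_prop)
  have h3 : 2 * (convolution F K (ContinuousLinearMap.mul ℝ ℝ) volume x - (∫ t, K t) * F x) =
      ∫ t, (F (x + t) + F (x - t) - 2 * F x) * K t := by
    have : (fun t => (F (x + t) + F (x - t) - 2 * F x) * K t) =
        fun t => F (x + t) * K t + F (x - t) * K t - 2 * F x * K t := by
      ext t; ring
    rw [this, integral_sub (by exact i1.add i2) i3, integral_add i1 i2, integral_const_mul, ← h2, h1]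
    ring
  have iA : Integrable (fun t : EuclideanSpace ℝ (Fin d) => ‖t‖ * |K t|) := by
    have := (hint (fun t => ‖t‖) continuous_norm).norm
    simpa using this
  have h4 : |∫ t, (F (x + t) + F (x - t) - 2 * F x) * K t| ≤ A * ∫ t, ‖t‖ * |K t| := by
    rw [← integral_const_mul, ← Real.norm_eq_abs]
    refine norm_integral_le_of_norm_le (iA.const_mul A) (ae_of_all _ fun t => ?_)
    rw [Real.norm_eq_abs, abs_mul, ← mul_assoc]
    exact mul_le_mul_of_nonneg_right (hFA x t) (abs_nonneg _)
  rw [← h3, abs_mul, abs_two] at h4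
  linarith [abs_nonneg (convolution F K (ContinuousLinearMap.mul ℝ ℝ) volume x
    - (∫ t, K t) * F x)]

/-- A bounded periodic function with second symmetric differences `O(‖y‖)` is approximated by
its mollifications at the scales `2 ^ (-j)`. -/
theorem memBesov_of_abs_second_difference_le {d : ℕ}
    {f : EuclideanSpace ℝ (Fin d) → ℝ} (hfc : Continuous f) (hfb : ∃ M, ∀ x, |f x| ≤ M)
    (hper : Per1 d f) {C : ℝ} (hC : ∀ x y : EuclideanSpace ℝ (Fin d), y ≠ 0 →
      |f (x + y) + f (x - y) - 2 * f x| ≤ C * ‖y‖) :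
    MemBesov d 1 2 f := by
  obtain ⟨M, hM⟩ := hfb
  let φ : ContDiffBump (0 : EuclideanSpace ℝ (Fin d)) := ⟨1, 2, one_pos, one_lt_two⟩
  set K : EuclideanSpace ℝ (Fin d) → ℝ := φ.normed volume
  have hKs : HasCompactSupport K := φ.hasCompactSupport_normed
  have hKd : ContDiff ℝ 2 K := φ.contDiff_normed
  have hKe : ∀ t, K (-t) = K t := φ.normed_neg
  have hK1 : ∫ t, K t = 1 := φ.integral_normed
  have hK0 : ∀ t, 0 ≤ K t := φ.nonneg_normed
  have hdK : ∀ k, ContDiff ℝ 1 (pderiv1 d k K) := fun k => contDiff_pderiv1 hKd (by norm_num) k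
  let G : ℝ → EuclideanSpace ℝ (Fin d) → ℝ := fun h =>
    convolution (fun z => f (h • z)) K (ContinuousLinearMap.mul ℝ ℝ) volume
  have hFc : ∀ h : ℝ, Continuous fun z : EuclideanSpace ℝ (Fin d) => f (h • z) :=
    fun h => by fun_prop
  have hzyg : ∀ h : ℝ, 0 < h → ∀ x y : EuclideanSpace ℝ (Fin d),
      |f (h • (x + y)) + f (h • (x - y)) - 2 * f (h • x)| ≤ C * h * ‖y‖ := by
    intro h hh x y
    rcases eq_or_ne y 0 with rfl | hy
    · simp [two_mul]
    · have := hC (h • x) (h • y) (smul_ne_zero hh.ne' hy)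
      rwa [norm_smul, Real.norm_of_nonneg hh.le, ← mul_assoc, ← smul_add, ← smul_sub] at this
  have hG : ∀ h x, G h x = ∫ t, f (h • (x - t)) * K t := fun h x => by
    simp only [G]; rw [convolution_eq_swap]; rfl
  refine ⟨fun j x => G ((1 / 2) ^ j) ((2 : ℝ) ^ j • x), fun j _ => ⟨⟨M, fun x => ?_⟩, ?_, ?_⟩,
    ⟨C * ∫ t, ‖t‖ * |K t|, fun j _ => supNorm_le_ofReal fun x => ?_⟩,
    ⟨∑ i, ∑ k, |C| * ∫ t, ‖t‖ * |pderiv1 d i (pderiv1 d k K) t|, fun α hα j _ =>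
      supNorm_le_ofReal fun x => ?_⟩⟩
  · simp only [hG]
    rw [← Real.norm_eq_abs]
    have hi : Integrable fun t => M * K t :=
      (hKd.continuous.integrable_of_hasCompactSupport hKs).const_mul M
    refine (norm_integral_le_of_norm_le hi (ae_of_all _ fun t => ?_)).trans_eq ?_
    · rw [Real.norm_eq_abs, abs_mul, abs_of_nonneg (hK0 t)]
      exact mul_le_mul_of_nonneg_right (hM _) (hK0 t)
    · rw [integral_const_mul, hK1, mul_one]
  · intro x i
    simp only [hG]
    congr 1
    ext t
    congr 1
    rw [smul_sub, smul_sub, smul_smul, smul_smul, ← mul_pow]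
    norm_num
    rw [add_sub_right_comm, hper]
  · exact (hKs.contDiff_convolution_right (n := 2) _ (hFc _).locallyIntegrable hKd).comp
      (contDiff_const_smul _)
  · have h := abs_convolution_sub_le (hFc ((1 / 2) ^ j)) (hzyg _ (by positivity)) hKs
      hKd.continuous hKe ((2 : ℝ) ^ j • x)
    rw [hK1, one_mul, smul_smul, ← mul_pow, show (1 / 2 * 2 : ℝ) = 1 by norm_num, one_pow,
      one_smul] at h
    rw [abs_sub_comm, mul_one, Real.rpow_neg two_pos.le, Real.rpow_natCast, ← inv_pow, ← one_div]
    exact h.trans_eq (by ring)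
  · obtain ⟨i, k, hα'⟩ := exists_pderivM_eq_pderiv1_pderiv1 hα
    have h := abs_convolution_sub_le (hFc ((1 / 2) ^ j)) (hzyg _ (by positivity))
      (hasCompactSupport_pderiv1 i (hasCompactSupport_pderiv1 k hKs))
      (contDiff_pderiv1 (m := 0) (hdK k) (by norm_num) i).continuous
      (pderiv1_pderiv1_even i k hKe) ((2 : ℝ) ^ j • x)
    rw [integral_pderiv1_eq_zero i (hasCompactSupport_pderiv1 k hKs) (hdK k), zero_mul, sub_zero,
      ← pderiv1_convolution i (hFc _) (hasCompactSupport_pderiv1 k hKs) (hdK k),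
      ← pderiv1_convolution k (hFc _) hKs (hKd.of_le (by norm_num))] at h
    rw [hα', pderiv1_comp_smul, pderiv1_const_mul, pderiv1_comp_smul,
      show ((2 : ℕ) : ℝ) - 1 = 1 by norm_num, one_mul, Real.rpow_natCast]
    have hnn : ∀ i k, 0 ≤ |C| * ∫ t, ‖t‖ * |pderiv1 d i (pderiv1 d k K) t| := fun i k =>
      mul_nonneg (abs_nonneg _) (integral_nonneg fun t => by positivity)
    have hle : |C| * ∫ t, ‖t‖ * |pderiv1 d i (pderiv1 d k K) t| ≤
        ∑ i, ∑ k, |C| * ∫ t, ‖t‖ * |pderiv1 d i (pderiv1 d k K) t| :=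
      (Finset.single_le_sum (f := fun k => |C| * ∫ t, ‖t‖ * |pderiv1 d i (pderiv1 d k K) t|)
        (fun k _ => hnn i k) (Finset.mem_univ k)).trans
      (Finset.single_le_sum
        (f := fun i => ∑ k, |C| * ∫ t, ‖t‖ * |pderiv1 d i (pderiv1 d k K) t|)
        (fun i _ => Finset.sum_nonneg fun k _ => hnn i k) (Finset.mem_univ i))
    have hI : 0 ≤ ∫ t, ‖t‖ * |pderiv1 d i (pderiv1 d k K) t| :=
      integral_nonneg fun t => by positivity
    set I := ∫ t, ‖t‖ * |pderiv1 d i (pderiv1 d k K) t|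
    have hpow : (2 : ℝ) ^ j * (1 / 2) ^ j = 1 := by rw [← mul_pow]; norm_num
    rw [abs_mul, abs_mul, abs_of_pos (by positivity : (0 : ℝ) < 2 ^ j)]
    calc (2 : ℝ) ^ j * (2 ^ j * |pderiv1 d i (pderiv1 d k (G ((1 / 2) ^ j))) ((2 : ℝ) ^ j • x)|)
        ≤ 2 ^ j * (2 ^ j * (C * (1 / 2) ^ j * I)) := by gcongr
      _ = C * I * 2 ^ j * (2 ^ j * (1 / 2) ^ j) := by ring
      _ = C * I * 2 ^ j := by rw [hpow, mul_one]
      _ ≤ |C| * I * 2 ^ j := by gcongr; exact le_abs_self C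
      _ ≤ _ := by gcongr

/-- Meyer's characterization of the Zygmund class (Proposition 2, case `β = 1`): a continuous
bounded 1-periodic function belongs to `B^1_{∞,∞}` in the approximation sense (with `N = 2`)
iff its second symmetric differences are `O(‖y‖)`. -/
theorem besov_one_iff_zygmund (d : ℕ) (hd : 1 ≤ d)
    (f : EuclideanSpace ℝ (Fin d) → ℝ) (hfc : Continuous f)
    (hfb : ∃ M, ∀ x, |f x| ≤ M) (hper : Per1 d f) :
    MemBesov d 1 2 f ↔
      ∃ C : ℝ, ∀ x y : EuclideanSpace ℝ (Fin d), y ≠ 0 →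
        |f (x + y) + f (x - y) - 2 * f x| ≤ C * ‖y‖ :=
  ⟨exists_abs_second_difference_le_of_memBesov hfc hfb,
    fun ⟨_, hC⟩ => memBesov_of_abs_second_difference_le hfc hfb hper hC⟩
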